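/- arXiv:2009.10502 — 2 statements merged into one kernel-verified Lean document; each statement's English description precedes it below -/
import Mathlib

section
/- Let p ≥ 1 be an integer, let C_1, C_2, …, C_h be pairwise disjoint finite sets with |C_1| ≥ |C_j| for every j, and set n' = Σ_{j=1}^{h} |C_j|. Let L be a finite set of integers with |L| ≥ n' and n' ≥ p·|C_1|. Then there exists an injective map f from C_1 ∪ C_2 ∪ … ∪ C_h into L such that for every j and every two distinct elements u, v ∈ C_j, |f(u) − f(v)| ≥ p. -/
open Finset

/-- The rank of `k` among the naturals below `n` ordered by decreasing residue modulo `m`, and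
increasingly within each residue class. -/
def residueRank (m n k : ℕ) : ℕ :=
  #{j ∈ range n | k % m < j % m ∨ (j % m = k % m ∧ j < k)}

theorem residueRank_lt {m n k : ℕ} (hk : k < n) : residueRank m n k < n := by
  refine (card_lt_card (filter_ssubset.2 ⟨k, mem_range.2 hk, ?_⟩)).trans_eq (card_range n)
  omega

theorem residueRank_lt_residueRank {m n a b : ℕ} (ha : a < n)
    (hab : b % m < a % m ∨ (a % m = b % m ∧ a < b)) :
    residueRank m n a < residueRank m n b := by
  refine card_lt_card (ssubset_iff_of_subset ?_ |>.2 ⟨a, ?_, ?_⟩)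
  · intro j
    simp only [mem_filter, mem_range]
    omega
  · simp [ha, hab]
  · simp

theorem residueRank_injOn (m n : ℕ) : Set.InjOn (residueRank m n) (Set.Iio n) := by
  intro a ha b hb hab
  by_contra hne
  have key : (b % m < a % m ∨ (a % m = b % m ∧ a < b)) ∨
      (a % m < b % m ∨ (b % m = a % m ∧ b < a)) := by omega
  rcases key with h | h
  · exact (residueRank_lt_residueRank ha h).ne hab
  · exact (residueRank_lt_residueRank hb h).ne' hab

theorem residueRank_add_le {m n p a b : ℕ} (hm : 0 < m) (hpn : p * m ≤ n)
    (hmod : b % m < a % m) (hdiv : a / m ≤ b / m) :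
    residueRank m n a + p ≤ residueRank m n b := by
  have ham := Nat.mod_lt a hm
  have hbm := Nat.mod_lt b hm
  let g : ℕ → ℕ := fun t => (if t < a / m then b % m else a % m) + m * t
  have hgmod (t : ℕ) : g t % m = if t < a / m then b % m else a % m := by
    simp only [g, Nat.add_mul_mod_self_left]
    split_ifs <;> simp
  have hgdiv (t : ℕ) : g t / m = t := by
    simp only [g, Nat.add_mul_div_left _ _ hm]
    split_ifs <;> simp [Nat.div_eq_of_lt, ham, hbm]
  have hglt (t : ℕ) (ht : t < p) : g t < n := by
    refine lt_of_lt_of_le ?_ hpn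
    rw [← Nat.div_lt_iff_lt_mul hm, hgdiv]
    exact ht
  have hinj : Function.Injective g := fun s t hst => by rw [← hgdiv s, ← hgdiv t, hst]
  rw [← card_range p, ← card_image_of_injective (range p) hinj, residueRank,
    ← card_union_of_disjoint]
  · refine card_le_card fun j hj => ?_
    rw [mem_union, mem_image] at hj
    rcases hj with hj | ⟨t, ht, rfl⟩
    · simp only [mem_filter, mem_range] at hj ⊢
      omega
    · have h1 := hgmod t
      rw [mem_filter, mem_range]
      refine ⟨hglt t (mem_range.1 ht), ?_⟩
      split_ifs at h1 with h
      · refine Or.inr ⟨h1, ?_⟩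
        refine lt_of_not_ge fun hge => ?_
        have := Nat.div_le_div_right (c := m) hge
        rw [hgdiv] at this
        omega
      · exact Or.inl (h1 ▸ hmod)
  · refine disjoint_left.2 fun j hj hj' => ?_
    obtain ⟨t, -, rfl⟩ := mem_image.1 hj'
    have h1 := hgmod t
    rw [mem_filter] at hj
    split_ifs at h1 with h
    · omega
    · have h2 : g t < a := by omega
      have h3 := Nat.div_add_mod (g t) m
      have h4 := Nat.div_add_mod a m
      rw [hgdiv] at h3
      have := Nat.mul_le_mul_left m (not_lt.1 h)
      omega

theorem residueRank_separated {m n p a b : ℕ} (hpn : p * m ≤ n) (hab : a < b)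
    (hba : b < a + m) :
    residueRank m n a + p ≤ residueRank m n b ∨ residueRank m n b + p ≤ residueRank m n a := by
  have hm : 0 < m := by omega
  have ha := Nat.div_add_mod a m
  have hb := Nat.div_add_mod b m
  have hbm := Nat.mod_lt b hm
  have ham := Nat.mod_lt a hm
  have hle : a / m ≤ b / m := Nat.div_le_div_right hab.le
  rcases hle.eq_or_lt with h | h
  · refine Or.inr (residueRank_add_le hm hpn ?_ h.ge)
    rw [h] at ha
    omega
  · refine Or.inl (residueRank_add_le hm hpn ?_ hle)
    have := Nat.mul_le_mul_left m (Nat.succ_le_of_lt h)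
    rw [Nat.mul_succ] at this
    omega

theorem Fin.sub_le_sub_of_strictMono {n : ℕ} {φ : Fin n → ℤ} (hφ : StrictMono φ) {i j : Fin n}
    (hij : i ≤ j) : (j : ℤ) - i ≤ φ j - φ i := by
  have hsub : (Ioc i j).image φ ⊆ Ioc (φ i) (φ j) := by
    intro x hx
    obtain ⟨k, hk, rfl⟩ := mem_image.1 hx
    rw [mem_Ioc] at hk ⊢
    exact ⟨hφ hk.1, hφ.monotone hk.2⟩
  have hcard := card_le_card hsub
  rw [card_image_of_injective _ hφ.injective, Fin.card_Ioc, Int.card_Ioc] at hcard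
  have := hφ.monotone hij
  have : (i : ℕ) ≤ j := hij
  omega

/-- Enumerating a disjoint family block by block puts each member in a window of its own length. -/
theorem exists_blockwise_enumeration {α : Type*} {h : ℕ} (C : Fin h → Finset α)
    (hdisj : ∀ i j : Fin h, i ≠ j → Disjoint (C i) (C j)) :
    ∃ e : α → ℕ, (∀ j, ∀ u ∈ C j, e u < ∑ i, #(C i)) ∧
      (∀ i j, ∀ u ∈ C i, ∀ v ∈ C j, e u = e v → u = v) ∧
      ∀ j, ∀ u ∈ C j, ∀ v ∈ C j, e v < e u + #(C j) := by
  let E (j : Fin h) (u : C j) : Fin (∑ i, #(C i)) := finSigmaFinEquiv ⟨j, (C j).equivFin u⟩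
  have hex (u : α) : ∃ k : ℕ, ∀ j (hj : u ∈ C j), k = E j ⟨u, hj⟩ := by
    by_cases hu : ∃ j, u ∈ C j
    · obtain ⟨i, hi⟩ := hu
      refine ⟨E i ⟨u, hi⟩, fun j hj => ?_⟩
      obtain rfl : i = j := by
        by_contra hne
        exact disjoint_left.1 (hdisj i j hne) hi hj
      rfl
    · exact ⟨0, fun j hj => (hu ⟨j, hj⟩).elim⟩
  choose e he using hex
  refine ⟨e, fun j u hu => ?_, fun i j u hu v hv huv => ?_, fun j u hu v hv => ?_⟩
  · rw [he u j hu]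
    exact (E j ⟨u, hu⟩).isLt
  · rw [he u i hu, he v j hv] at huv
    have hs := finSigmaFinEquiv.injective (Fin.ext huv)
    obtain ⟨rfl, hs⟩ := Sigma.mk.inj_iff.1 hs
    simpa using hs
  · rw [he u j hu, he v j hv]
    simp only [E, finSigmaFinEquiv_apply]
    have := ((C j).equivFin ⟨v, hv⟩).isLt
    omega


/-- Labeling disjoint cliques `C 0, …, C (h-1)` (with `C 0` the largest) from a
label set `L`: if `|L| ≥ n' = Σ |C j|` and `n' ≥ p·|C 0|`, there is an injective
assignment of labels from `L` such that within each clique any two labels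
differ by at least `p`. -/
theorem cliques_labeling {α : Type*} [DecidableEq α] (p h : ℕ) (hp : 1 ≤ p)
    (h0 : 0 < h) (C : Fin h → Finset α)
    (hdisj : ∀ i j : Fin h, i ≠ j → Disjoint (C i) (C j))
    (hmax : ∀ j : Fin h, (C j).card ≤ (C ⟨0, h0⟩).card)
    (L : Finset ℤ)
    (hL : ∑ j : Fin h, (C j).card ≤ L.card)
    (hbig : p * (C ⟨0, h0⟩).card ≤ ∑ j : Fin h, (C j).card) :
    ∃ f : α → ℤ,
      (∀ j : Fin h, ∀ u ∈ C j, f u ∈ L) ∧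
      Set.InjOn f ↑(Finset.univ.biUnion C) ∧
      ∀ j : Fin h, ∀ u ∈ C j, ∀ v ∈ C j, u ≠ v → (p : ℤ) ≤ |f u - f v| := by
  obtain ⟨e, he_lt, he_inj, he_win⟩ := exists_blockwise_enumeration C hdisj
  set n := ∑ j : Fin h, (C j).card
  set m := (C ⟨0, h0⟩).card
  let φ : Fin n ↪o ℤ := L.orderEmbOfCardLe hL
  let f : α → ℤ := fun u =>
    if hu : e u < n then φ ⟨residueRank m n (e u), residueRank_lt hu⟩ else 0
  have hf {j : Fin h} {u : α} (hu : u ∈ C j) :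
      f u = φ ⟨residueRank m n (e u), residueRank_lt (he_lt j u hu)⟩ :=
    dif_pos (he_lt j u hu)
  have hgap {i j : Fin h} {u v : α} (hu : u ∈ C i) (hv : v ∈ C j)
      (huv : residueRank m n (e u) + p ≤ residueRank m n (e v)) : (p : ℤ) ≤ f v - f u := by
    rw [hf hu, hf hv]
    refine le_trans ?_ (Fin.sub_le_sub_of_strictMono φ.strictMono (Fin.mk_le_mk.2 (by omega)))
    push_cast
    omega
  have hsep {j : Fin h} {u v : α} (hu : u ∈ C j) (hv : v ∈ C j) (huv : e u < e v) :
      (p : ℤ) ≤ |f u - f v| := by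
    have hwin := (he_win j u hu v hv).trans_le (Nat.add_le_add_left (hmax j) _)
    rcases residueRank_separated hbig huv hwin with hr | hr
    · rw [abs_sub_comm]
      exact (hgap hu hv hr).trans (le_abs_self _)
    · exact (hgap hv hu hr).trans (le_abs_self _)
  refine ⟨f, fun j u hu => ?_, fun u hu v hv huv => ?_, fun j u hu v hv huv => ?_⟩
  · rw [hf hu]
    exact L.orderEmbOfCardLe_mem hL _
  · simp only [coe_biUnion, Set.mem_iUnion, mem_coe, mem_univ] at hu hv
    obtain ⟨i, -, hu⟩ := hu
    obtain ⟨j, -, hv⟩ := hv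
    rw [hf hu, hf hv] at huv
    exact he_inj i j u hu v hv (residueRank_injOn m n (he_lt i u hu) (he_lt j v hv)
      (Fin.mk.inj_iff.1 (φ.injective huv)))
  · rcases lt_trichotomy (e u) (e v) with hlt | heq | hlt
    · exact hsep hu hv hlt
    · exact (huv (he_inj j j u hu v hv heq)).elim
    · rw [abs_sub_comm]
      exact hsep hv hu hlt
end

section
/- Let p ≥ 1 and k ≥ 0 be integers, let G be a finite simple graph, and let X be a twin cover of G. For a vertex v ∉ X let T_v = {u ∉ X : N_G(u) ∩ X = N_G(v) ∩ X} be the type of v, and suppose that for every v ∉ X, every clique of G contained in T_v has size at most |T_v|/p. If G admits a k-L(p,1)-labeling, then G admits a k-L(p,1)-labeling f such that for every x ∈ X, either f(x) ≤ (2p−1)|X| − p or f(x) ≥ k − (2p−1)|X| + p. -/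
/-- `f` is an `L(p,1)`-labeling of `G`: labels of adjacent vertices differ by
at least `p`, and vertices at distance exactly 2 get distinct labels. -/
def IsLp1Labeling {V : Type*} (p : ℕ) (G : SimpleGraph V) (f : V → ℕ) : Prop :=
  (∀ u v : V, G.Adj u v → (p : ℤ) ≤ |(f u : ℤ) - (f v : ℤ)|) ∧
  (∀ u v : V, u ≠ v → ¬ G.Adj u v → (∃ w, G.Adj u w ∧ G.Adj w v) → f u ≠ f v)

/-- A `k`-`L(p,1)`-labeling: an `L(p,1)`-labeling with values in `{0, …, k}`. -/
def IsKLp1Labeling {V : Type*} (p k : ℕ) (G : SimpleGraph V) (f : V → ℕ) : Prop :=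
  (∀ v, f v ≤ k) ∧ IsLp1Labeling p G f

/-- Adjacent vertices `u`, `v` are true twins: they have the same closed
neighborhood `N[u] = N[v]`. -/
def TrueTwins {V : Type*} (G : SimpleGraph V) (u v : V) : Prop :=
  G.Adj u v ∧ ∀ w, w ≠ u → w ≠ v → (G.Adj u w ↔ G.Adj v w)

/-- `X` is a twin cover of `G`: every edge has an endpoint in `X` or joins
true twins. -/
def IsTwinCover {V : Type*} (G : SimpleGraph V) (X : Finset V) : Prop :=
  ∀ u v : V, G.Adj u v → u ∈ X ∨ v ∈ X ∨ TrueTwins G u v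

/-- The type of a vertex `v ∉ X` w.r.t. a twin cover `X`:
`T_v = {u ∉ X : N(u) ∩ X = N(v) ∩ X}`. -/
def typeOf {V : Type*} [Fintype V] [DecidableEq V] (G : SimpleGraph V)
    [DecidableRel G.Adj] (X : Finset V) (v : V) : Finset V :=
  Finset.univ.filter (fun u => u ∉ X ∧ ∀ x ∈ X, (G.Adj u x ↔ G.Adj v x))

/-- The numbers below `m` can be rearranged so that any two of them at distance less than `p`
are placed at least `m / p` apart. -/
theorem exists_spreading (p m : ℕ) (hp : 1 ≤ p) :
    ∃ pos : ℕ → ℕ, (∀ a < m, pos a < m) ∧ (∀ a < m, ∀ b < m, pos a = pos b → a = b) ∧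
      ∀ a b, a < b → b < a + p → pos a + m / p ≤ pos b ∨ pos b + m / p ≤ pos a := by
  obtain ⟨q, hq⟩ : ∃ q, q = m / p := ⟨_, rfl⟩
  obtain ⟨t, ht⟩ : ∃ t, t = m % p := ⟨_, rfl⟩
  have hm : p * q + t = m := by rw [hq, ht]; exact Nat.div_add_mod m p
  rw [← hq]
  obtain ⟨A, hA⟩ : ∃ A : ℕ → ℕ, ∀ r, A r = (p - 1 - r) * q + (t - 1 - r) := ⟨_, fun _ => rfl⟩
  have step : ∀ r s, r < s → s < p → A s + q + (if s < t then 1 else 0) ≤ A r := by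
    intro r s hrs hs
    have h1 : (p - 1 - s + 1) * q ≤ (p - 1 - r) * q := Nat.mul_le_mul_right _ (by omega)
    rw [add_mul, one_mul] at h1
    rw [hA, hA]
    split_ifs <;> omega
  have hzero : A 0 + q + (if 0 < t then 1 else 0) = m := by
    obtain ⟨p', rfl⟩ : ∃ p', p = p' + 1 := ⟨p - 1, by omega⟩
    rw [add_mul, one_mul] at hm
    rw [hA]
    simp only [Nat.add_sub_cancel, Nat.sub_zero]
    split_ifs <;> omega
  have quot : ∀ a < m, a / p < q + (if a % p < t then 1 else 0) := by
    intro a ha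
    have h1 := Nat.div_add_mod a p
    have h2 : a / p ≤ q := hq ▸ Nat.div_le_div_right ha.le
    rcases h2.lt_or_eq with h | h
    · omega
    · rw [h] at h1 ⊢
      rw [if_pos (by omega)]
      omega
  have hmod : ∀ a, a % p < p := fun a => Nat.mod_lt _ hp
  have hne : ∀ a < m, ∀ b < m, a % p < b % p → A (b % p) + b / p < A (a % p) + a / p := by
    intro a _ b hb h
    have := step _ _ h (hmod b)
    have := quot b hb
    have := Nat.zero_le (a / p)
    omega
  refine ⟨fun a => A (a % p) + a / p, ?_, ?_, ?_⟩
  · intro a ha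
    have := quot a ha
    dsimp only
    rcases Nat.eq_zero_or_pos (a % p) with h | h
    · rw [h] at this ⊢
      omega
    · have := step _ _ h (hmod a)
      omega
  · intro a ha b hb h
    dsimp only at h
    rcases lt_trichotomy (a % p) (b % p) with h' | h' | h'
    · have := hne a ha b hb h'
      omega
    · rw [h'] at h
      rw [← Nat.div_add_mod a p, ← Nat.div_add_mod b p, h', Nat.add_left_cancel h]
    · have := hne b hb a ha h'
      omega
  · intro a b hab hba
    dsimp only
    have ha := Nat.div_add_mod a p
    have hb := Nat.div_add_mod b p
    have hma := hmod a
    have hmb := hmod b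
    have h1 : a / p ≤ b / p := Nat.div_le_div_right hab.le
    have h2 : b / p ≤ a / p + 1 := by
      rw [← Nat.add_div_right a hp]
      exact Nat.div_le_div_right hba.le
    rcases Nat.lt_or_ge (a / p) (b / p) with h | h
    · have h3 : b / p = a / p + 1 := by omega
      rw [h3, mul_add, mul_one] at hb
      have := step (b % p) (a % p) (by omega) hma
      omega
    · have h3 : b / p = a / p := by omega
      rw [h3] at hb
      have := step (a % p) (b % p) (by omega) hmb
      omega

/-- The number of elements of `T` with a smaller `φ`-value than `v`. -/
def rankIn {V L : Type*} [LinearOrder L] (T : Finset V) (φ : V → L) (v : V) : ℕ :=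
  (T.filter (fun u => φ u < φ v)).card

section rankIn

variable {V L : Type*} [LinearOrder L] {T : Finset V} {φ : V → L} {u v : V}

theorem rankIn_lt_card (hv : v ∈ T) : rankIn T φ v < T.card := by
  refine Finset.card_lt_card ⟨Finset.filter_subset _ _, fun h => ?_⟩
  simpa using h hv

theorem rankIn_add_card (h : φ u ≤ φ v) :
    rankIn T φ v = rankIn T φ u + (T.filter (fun w => φ u ≤ φ w ∧ φ w < φ v)).card := by
  classical
  unfold rankIn
  rw [← Finset.card_union_of_disjoint]
  · congr 1
    ext w
    simp only [Finset.mem_filter, Finset.mem_union, ← and_or_left]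
    refine and_congr_right fun _ => ⟨fun hw => ?_, ?_⟩
    · exact (lt_or_ge (φ w) (φ u)).imp_right fun h' => ⟨h', hw⟩
    · rintro (hw | hw)
      exacts [hw.trans_le h, hw.2]
  · rw [Finset.disjoint_filter]
    exact fun w _ h1 h2 => absurd h1 (not_lt.2 h2.1)

theorem rankIn_lt_rankIn (hu : u ∈ T) (h : φ u < φ v) : rankIn T φ u < rankIn T φ v := by
  rw [rankIn_add_card h.le]
  have : 0 < (T.filter (fun w => φ u ≤ φ w ∧ φ w < φ v)).card :=
    Finset.card_pos.2 ⟨u, by simp [hu, h]⟩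
  omega

theorem rankIn_injOn (hφ : Set.InjOn φ T) : Set.InjOn (rankIn T φ) T := by
  intro u hu v hv h
  rcases lt_trichotomy (φ u) (φ v) with h' | h' | h'
  · exact absurd h (rankIn_lt_rankIn hu h').ne
  · exact hφ hu hv h'
  · exact absurd h (rankIn_lt_rankIn hv h').ne'

theorem rankIn_le_add_sub {g : V → ℕ} (hg : Set.InjOn g T) (h : g u ≤ g v) :
    rankIn T g v ≤ rankIn T g u + (g v - g u) := by
  rw [rankIn_add_card h, ← Nat.card_Ico]
  refine Nat.add_le_add_left (Finset.card_le_card_of_injOn g ?_ ?_) _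
  · intro w hw
    simpa using (Finset.mem_filter.1 hw).2
  · exact hg.mono fun w hw => (Finset.mem_filter.1 hw).1

theorem rankIn_lex_lt {κ g : V → ℕ} (hv : v ∈ T) (hκ : κ u = κ v) (h : g u ≤ g v) :
    rankIn T (fun w => toLex (κ w, g w)) v <
      rankIn T (fun w => toLex (κ w, g w)) u + (T.filter (fun w => κ w = κ v)).card := by
  have hle : toLex (κ u, g u) ≤ toLex (κ v, g v) := by
    rw [Prod.Lex.toLex_le_toLex]
    exact Or.inr ⟨hκ, h⟩
  rw [rankIn_add_card (φ := fun w => toLex (κ w, g w)) hle]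
  refine Nat.add_lt_add_left (Finset.card_lt_card ⟨?_, fun hsub => ?_⟩) _
  · intro w hw
    simp only [Finset.mem_filter, Prod.Lex.toLex_le_toLex, Prod.Lex.toLex_lt_toLex] at hw ⊢
    exact ⟨hw.1, by omega⟩
  · have := hsub (Finset.mem_filter.2 ⟨hv, rfl⟩)
    simp at this

end rankIn

/-- Distinct labels on `T` can be permuted so that members of the same class of `κ` receive
labels at least `p` apart, provided that all classes have size at most `#T / p`. -/
theorem exists_separating_rearrangement {V : Type*} (p : ℕ) (hp : 1 ≤ p) (T : Finset V)
    (κ g : V → ℕ) (hg : Set.InjOn g T)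
    (hcard : ∀ v ∈ T, p * (T.filter (fun w => κ w = κ v)).card ≤ T.card) :
    ∃ σ : V → V, (∀ v ∈ T, σ v ∈ T) ∧ Set.InjOn σ T ∧
      ∀ u ∈ T, ∀ v ∈ T, u ≠ v → κ u = κ v →
        (p : ℤ) ≤ |(g (σ u) : ℤ) - (g (σ v) : ℤ)| := by
  obtain ⟨pos, pos_lt, pos_inj, pos_far⟩ := exists_spreading p T.card hp
  set E : V → ℕ := rankIn T (fun w => toLex (κ w, g w)) with hE
  set F : V → ℕ := fun w => pos (rankIn T g w) with hF
  have hEinj : Set.InjOn E T := rankIn_injOn fun u hu v hv h =>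
    hg hu hv (by simpa using congrArg (fun z => (ofLex z).2) h)
  have hFinj : Set.InjOn F T := fun u hu v hv h =>
    rankIn_injOn hg hu hv (pos_inj _ (rankIn_lt_card hu) _ (rankIn_lt_card hv) h)
  have hsurj : Set.SurjOn F T (Finset.range T.card) :=
    Finset.surjOn_of_injOn_of_card_le F
      (fun u hu => by simpa using pos_lt _ (rankIn_lt_card hu)) hFinj (by simp)
  have hex : ∀ v, ∃ w, v ∈ T → w ∈ T ∧ F w = E v := by
    intro v
    by_cases hv : v ∈ T
    · obtain ⟨w, hw, h⟩ := hsurj (show E v ∈ _ by simpa using rankIn_lt_card hv)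
      exact ⟨w, fun _ => ⟨hw, h⟩⟩
    · exact ⟨v, fun h => absurd h hv⟩
  choose σ hσ using hex
  have hσinj : Set.InjOn σ T := fun u hu v hv h =>
    hEinj hu hv (by rw [← (hσ u hu).2, ← (hσ v hv).2, h])
  refine ⟨σ, fun v hv => (hσ v hv).1, hσinj, ?_⟩
  have hclose : ∀ u ∈ T, ∀ v ∈ T, κ u = κ v → E v < E u + T.card / p := by
    intro u hu v hv h
    have hc : (T.filter (fun w => κ w = κ v)).card ≤ T.card / p := by
      rw [Nat.le_div_iff_mul_le hp, mul_comm]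
      exact hcard v hv
    rcases le_total (g u) (g v) with h' | h'
    · exact (rankIn_lex_lt hv h h').trans_le (Nat.add_le_add_left hc _)
    · have hle : E v ≤ E u := by
        rw [hE, rankIn_add_card (u := v) (v := u)]
        · omega
        · exact Prod.Lex.toLex_le_toLex.2 (Or.inr ⟨h.symm, h'⟩)
      have : 0 < (T.filter (fun w => κ w = κ v)).card :=
        Finset.card_pos.2 ⟨v, by simp [hv]⟩
      omega
  have main : ∀ u ∈ T, ∀ v ∈ T, u ≠ v → κ u = κ v → g (σ u) ≤ g (σ v) →
      g (σ u) + p ≤ g (σ v) := by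
    intro u hu v hv huv h hle
    by_contra! hlt
    have h1 := rankIn_le_add_sub hg hle
    have h2 : g (σ u) < g (σ v) := hle.lt_of_ne fun h' =>
      huv (hσinj hu hv (hg (hσ u hu).1 (hσ v hv).1 h'))
    have h3 := rankIn_lt_rankIn (φ := g) (hσ u hu).1 h2
    have h4 := pos_far _ _ h3 (by omega)
    have h5 : pos (rankIn T g (σ u)) = E u := (hσ u hu).2
    have h6 : pos (rankIn T g (σ v)) = E v := (hσ v hv).2
    have h7 := hclose u hu v hv h
    have h8 := hclose v hv u hu h.symm
    omega
  intro u hu v hv huv h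
  rcases le_total (g (σ u)) (g (σ v)) with h' | h'
  · have := main u hu v hv huv h h'
    rw [le_abs]
    omega
  · have := main v hv u hu huv.symm h.symm h'
    rw [le_abs]
    omega

/-- The labels `0, …, k` can be permuted so that those in `A` move to within
`(2p−1)·#A` of the two ends, without bringing any label closer than `p` to a label of `A`
from which it was at least `p` away. -/
theorem exists_compression (p k : ℕ) (hp : 1 ≤ p) (A : Finset ℕ) (hA : ∀ a ∈ A, a ≤ k) :
    ∃ π : ℕ → ℕ, (∀ a ≤ k, π a ≤ k) ∧ (∀ a b, π a = π b → a = b) ∧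
      (∀ a ∈ A, ∀ b ≤ k, a + p ≤ b ∨ b + p ≤ a → π a + p ≤ π b ∨ π b + p ≤ π a) ∧
      ∀ a ∈ A, π a + p ≤ (2 * p - 1) * A.card ∨ k + p ≤ (2 * p - 1) * A.card + π a := by
  classical
  set B : ℕ → Prop := fun b => ∃ a ∈ A, b < a + p ∧ a < b + p with hB
  have hBA : ∀ a ∈ A, ∀ b, b < a + p → a < b + p → B b := fun a ha b h1 h2 => ⟨a, ha, h1, h2⟩
  have hcardB : ∀ n, Nat.count B n ≤ (2 * p - 1) * A.card := by
    intro n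
    rw [Nat.count_eq_card_filter_range]
    calc _ ≤ (A.biUnion fun a => Finset.Ico (a + 1 - p) (a + p)).card := by
          refine Finset.card_le_card fun b hb => ?_
          obtain ⟨a, ha, h1, h2⟩ := (Finset.mem_filter.1 hb).2
          exact Finset.mem_biUnion.2 ⟨a, ha, Finset.mem_Ico.2 ⟨by omega, by omega⟩⟩
      _ ≤ A.card * (2 * p - 1) := by
          refine Finset.card_biUnion_le_card_mul _ _ _ fun a _ => ?_
          rw [Nat.card_Ico]
          omega
      _ = _ := mul_comm _ _
  have hrex : ∃ r, r ≤ k + 1 ∧ ∀ b, r ≤ b → b ≤ k → B b := ⟨k + 1, le_rfl, by omega⟩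
  obtain ⟨r, hr⟩ : ∃ r, r = Nat.find hrex := ⟨_, rfl⟩
  have hr1 : r ≤ k + 1 := hr ▸ (Nat.find_spec hrex).1
  have hr2 : ∀ b, r ≤ b → b ≤ k → B b := hr ▸ (Nat.find_spec hrex).2
  have hr3 : ∀ s, s ≤ k + 1 → (∀ b, s ≤ b → b < r → b ≤ k → B b) → r ≤ s := by
    intro s hs h
    rw [hr]
    refine Nat.find_min' hrex ⟨hs, fun b h1 h2 => ?_⟩
    rcases lt_or_ge b r with h3 | h3
    exacts [h b h1 h3 h2, hr2 b h3 h2]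
  -- A block of `A` lies entirely below `r` or entirely above.
  have hlow : ∀ a ∈ A, a < r → a + p ≤ r := by
    intro a ha h
    by_contra! h'
    have := hr3 a (by omega) fun b h1 h2 _ => hBA a ha b (by omega) (by omega)
    omega
  have hhigh : ∀ a ∈ A, r ≤ a → r ≤ a + 1 - p := by
    intro a ha h
    have := hA a ha
    exact hr3 _ (by omega) fun b h1 h2 _ => hBA a ha b (by omega) (by omega)
  have hsplit : ∀ n, Nat.count B n + Nat.count (fun b => ¬ B b) n = n := by
    intro n
    rw [Nat.count_eq_card_filter_range, Nat.count_eq_card_filter_range,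
      Finset.card_filter_add_card_filter_not, Finset.card_range]
  have hrun : ∀ d n, (∀ b, n ≤ b → b < n + d → B b) → Nat.count B (n + d) = Nat.count B n + d := by
    intro d
    induction d with
    | zero => simp
    | succ d ih =>
      intro n h
      rw [← add_assoc, Nat.count_succ, if_pos (h _ (by omega) (by omega)),
        ih n fun b h1 h2 => h b h1 (by omega)]
      rfl
  have hmono : ∀ {m n}, m ≤ n → Nat.count B m ≤ Nat.count B n := fun h => Nat.count_monotone _ h
  have hmono' : ∀ {m n}, m ≤ n → Nat.count (fun b => ¬ B b) m ≤ Nat.count (fun b => ¬ B b) n :=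
    fun h => Nat.count_monotone _ h
  have hsucc : ∀ {n}, B n → Nat.count B (n + 1) = Nat.count B n + 1 := fun h => by
    rw [Nat.count_succ, if_pos h]
  have hsucc' : ∀ {n}, ¬ B n →
      Nat.count (fun b => ¬ B b) (n + 1) = Nat.count (fun b => ¬ B b) n + 1 := fun h => by
    rw [Nat.count_succ, if_pos h]
  have hself : ∀ a ∈ A, B a := fun a ha => hBA a ha a (by omega) (by omega)
  have hup : ∀ a ∈ A, Nat.count B (a + p) = Nat.count B a + p := fun a ha =>
    hrun p a fun b h1 h2 => hBA a ha b (by omega) (by omega)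
  obtain ⟨π, hπ⟩ : ∃ π : ℕ → ℕ, ∀ a, π a = if r ≤ a then a else
      if B a then Nat.count B a else Nat.count B r + Nat.count (fun b => ¬ B b) a := ⟨_, fun _ => rfl⟩
  have hπ1 : ∀ {a}, r ≤ a → π a = a := fun h => by rw [hπ, if_pos h]
  have hπ2 : ∀ {a}, a < r → B a → π a = Nat.count B a := fun h h' => by
    rw [hπ, if_neg (by omega), if_pos h']
  have hπ3 : ∀ {a}, a < r → ¬ B a →
      π a = Nat.count B r + Nat.count (fun b => ¬ B b) a := fun h h' => by
    rw [hπ, if_neg (by omega), if_neg h']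
  have hsr := hsplit r
  have hπr : ∀ {a}, a < r → π a < r := by
    intro a h
    by_cases hb : B a
    · rw [hπ2 h hb]
      have := hsucc hb
      have := hmono (show a + 1 ≤ r by omega)
      omega
    · rw [hπ3 h hb]
      have := hsucc' hb
      have := hmono' (show a + 1 ≤ r by omega)
      omega
  have hπB : ∀ {a}, a < r → B a → π a < Nat.count B r := by
    intro a h hb
    rw [hπ2 h hb]
    have := hsucc hb
    have := hmono (show a + 1 ≤ r by omega)
    omega
  have hπne : ∀ a b, a < b → π a ≠ π b := by
    intro a b hab
    rcases lt_or_ge b r with hb | hb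
    · have ha : a < r := by omega
      by_cases h1 : B a <;> by_cases h2 : B b
      · rw [hπ2 ha h1, hπ2 hb h2]
        have := hsucc h1
        have := hmono (show a + 1 ≤ b by omega)
        omega
      · have := hπB ha h1
        rw [hπ3 hb h2]
        omega
      · have := hπB hb h2
        rw [hπ3 ha h1]
        omega
      · rw [hπ3 ha h1, hπ3 hb h2]
        have := hsucc' h1
        have := hmono' (show a + 1 ≤ b by omega)
        omega
    · rw [hπ1 hb]
      rcases lt_or_ge a r with ha | ha
      · have := hπr ha
        omega
      · rw [hπ1 ha]
        omega
  refine ⟨π, ?_, ?_, ?_, ?_⟩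
  · intro a ha
    rcases lt_or_ge a r with h | h
    · have := hπr h
      omega
    · rwa [hπ1 h]
  · intro a b h
    rcases lt_trichotomy a b with h' | h' | h'
    exacts [absurd h (hπne a b h'), h', absurd h.symm (hπne b a h')]
  · intro a ha b hb hab
    rcases lt_or_ge a r with h | h
    · have hlr := hmono (hlow a ha h)
      have hua := hup a ha
      have hpa := hπ2 h (hself a ha)
      rcases lt_or_ge b r with h' | h'
      · by_cases hBb : B b
        · have hpb := hπ2 h' hBb
          rcases hab with hab | hab
          · have := hmono hab
            omega
          · have h1 := hsucc hBb
            have h2 := hmono (show b + 1 ≤ a + 1 - p by omega)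
            have h3 := hrun (p - 1) (a + 1 - p) fun c h1 h2 => hBA a ha c (by omega) (by omega)
            rw [show a + 1 - p + (p - 1) = a by omega] at h3
            omega
        · rw [hπ3 h' hBb]
          omega
      · rw [hπ1 h']
        omega
    · have hh := hhigh a ha h
      rw [hπ1 h]
      rcases lt_or_ge b r with h' | h'
      · have := hπr h'
        omega
      · rw [hπ1 h']
        exact hab
  · intro a ha
    rcases lt_or_ge a r with h | h
    · have hlr := hmono (hlow a ha h)
      have hua := hup a ha
      have hpa := hπ2 h (hself a ha)
      have := hcardB r
      omega
    · have hh := hhigh a ha h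
      have hak := hA a ha
      rw [hπ1 h]
      have h1 : 1 ≤ A.card := Finset.card_pos.2 ⟨a, ha⟩
      have h2 : 2 * p - 1 ≤ (2 * p - 1) * A.card := Nat.le_mul_of_pos_right _ h1
      have h3 := hrun (k + 1 - r) r fun b h1 h2 => hr2 b h1 (by omega)
      have := hcardB (r + (k + 1 - r))
      omega

/-- Distinct vertices with a common neighbor have distinct labels. -/
theorem IsLp1Labeling.ne_of_common_neighbor {V : Type*} {p : ℕ} {G : SimpleGraph V} {f : V → ℕ}
    (hf : IsLp1Labeling p G f) (hp : 1 ≤ p) {u v w : V} (huv : u ≠ v) (hu : G.Adj u w)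
    (hv : G.Adj v w) : f u ≠ f v := by
  by_cases h : G.Adj u v
  · intro he
    have := hf.1 u v h
    rw [he] at this
    simp at this
    omega
  · exact hf.2 u v huv h ⟨w, hu, hv.symm⟩

theorem mem_typeOf {V : Type*} [Fintype V] [DecidableEq V] {G : SimpleGraph V}
    [DecidableRel G.Adj] {X : Finset V} {u v : V} :
    u ∈ typeOf G X v ↔ u ∉ X ∧ ∀ x ∈ X, (G.Adj u x ↔ G.Adj v x) := by
  simp [typeOf]

theorem typeOf_eq_of_mem {V : Type*} [Fintype V] [DecidableEq V] {G : SimpleGraph V}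
    [DecidableRel G.Adj] {X : Finset V} {u v : V} (h : u ∈ typeOf G X v) :
    typeOf G X u = typeOf G X v := by
  ext w
  rw [mem_typeOf, mem_typeOf]
  exact and_congr_right fun _ => forall₂_congr fun x hx => by rw [(mem_typeOf.1 h).2 x hx]

/-- A labeling that separates `X` from its neighbors can be rearranged inside the types so that
adjacent vertices outside `X` also get labels at least `p` apart. -/
theorem exists_rearrangement_of_types {V : Type*} [Fintype V] [DecidableEq V]
    (G : SimpleGraph V) [DecidableRel G.Adj] (p : ℕ) (hp : 1 ≤ p)
    (X : Finset V) (hX : IsTwinCover G X)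
    (hcl : ∀ v : V, v ∉ X → ∀ C : Finset V, G.IsClique ↑C → C ⊆ typeOf G X v →
      p * C.card ≤ (typeOf G X v).card)
    (g : V → ℕ) (hg : ∀ u v w, u ≠ v → G.Adj u w → G.Adj v w → g u ≠ g v) :
    ∃ σ : V → V, (∀ v, v ∉ X → (∃ x ∈ X, G.Adj v x) → σ v ∈ typeOf G X v) ∧
      (∀ u v x, u ∉ X → v ∉ X → x ∈ X → G.Adj u x → G.Adj v x → u ≠ v → σ u ≠ σ v) ∧
      ∀ u v, u ∉ X → v ∉ X → (∃ x ∈ X, G.Adj v x) → G.Adj u v →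
        (p : ℤ) ≤ |(g (σ u) : ℤ) - (g (σ v) : ℤ)| := by
  obtain ⟨ι, hι⟩ : ∃ ι : Finset V → ℕ, Function.Injective ι :=
    ⟨fun s => Fintype.equivFin (Finset V) s,
      Fin.val_injective.comp (Fintype.equivFin (Finset V)).injective⟩
  set N : V → Finset V := fun v => insert v (G.neighborFinset v) with hN
  have hNadj : ∀ u v, u ≠ v → N u = N v → G.Adj u v := by
    intro u v huv h
    have : v ∈ N u := h ▸ Finset.mem_insert_self _ _
    simpa [hN, huv.symm] using this
  have htwin : ∀ u v, u ∉ X → v ∉ X → G.Adj u v → TrueTwins G u v := fun u v hu hv h =>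
    ((hX u v h).resolve_left hu).resolve_left hv
  have hNeq : ∀ u v, TrueTwins G u v → N u = N v := by
    intro u v h
    ext w
    simp only [hN, Finset.mem_insert, SimpleGraph.mem_neighborFinset]
    by_cases h1 : w = u
    · subst h1
      simp [h.1.symm]
    · by_cases h2 : w = v
      · subst h2
        simp [h.1]
      · simp [h1, h2, h.2 w h1 h2]
  have key : ∀ T : Finset V, ∃ σ : V → V, ∀ v, v ∉ X → (∃ x ∈ X, G.Adj v x) → typeOf G X v = T →
      (∀ v ∈ T, σ v ∈ T) ∧ Set.InjOn σ T ∧ ∀ u ∈ T, ∀ v ∈ T, u ≠ v → ι (N u) = ι (N v) →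
        (p : ℤ) ≤ |(g (σ u) : ℤ) - (g (σ v) : ℤ)| := by
    intro T
    by_cases h : ∃ v, v ∉ X ∧ (∃ x ∈ X, G.Adj v x) ∧ typeOf G X v = T
    · obtain ⟨v, hv, ⟨x, hx, hvx⟩, rfl⟩ := h
      obtain ⟨σ, hσ⟩ := exists_separating_rearrangement p hp (typeOf G X v) (fun u => ι (N u)) g
        (fun a ha b hb hab => by
          by_contra hne
          exact hg a b x hne (((mem_typeOf.1 ha).2 x hx).2 hvx)
            (((mem_typeOf.1 hb).2 x hx).2 hvx) hab)
        (fun u _ => hcl v hv _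
          (fun a ha b hb hab => hNadj a b hab (hι (by
            simp only [Finset.coe_filter, Set.mem_ofPred_eq] at ha hb
            exact ha.2.trans hb.2.symm)))
          (Finset.filter_subset _ _))
      exact ⟨σ, fun _ _ _ _ => hσ⟩
    · exact ⟨id, fun v h1 h2 h3 => absurd ⟨v, h1, h2, h3⟩ h⟩
  choose σ hσ using key
  have hself : ∀ v, v ∉ X → v ∈ typeOf G X v := fun v hv => mem_typeOf.2 ⟨hv, fun _ _ => Iff.rfl⟩
  have hmem : ∀ v, v ∉ X → (∃ x ∈ X, G.Adj v x) → σ (typeOf G X v) v ∈ typeOf G X v :=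
    fun v hv hvx => (hσ _ v hv hvx rfl).1 v (hself v hv)
  refine ⟨fun v => σ (typeOf G X v) v, hmem, ?_, ?_⟩
  · intro u v x hu hv hx hux hvx huv h
    dsimp only at h
    have h1 := typeOf_eq_of_mem (hmem u hu ⟨x, hx, hux⟩)
    have h2 := typeOf_eq_of_mem (hmem v hv ⟨x, hx, hvx⟩)
    have h3 : typeOf G X u = typeOf G X v := by rw [← h1, ← h2, h]
    rw [h3] at h
    exact huv ((hσ _ v hv ⟨x, hx, hvx⟩ rfl).2.1 (h3 ▸ hself u hu) (hself v hv) h)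
  · intro u v hu hv hvx huv
    have ht := htwin u v hu hv huv
    have hut : u ∈ typeOf G X v := mem_typeOf.2 ⟨hu, fun x hx =>
      ht.2 x (fun h => hu (h ▸ hx)) (fun h => hv (h ▸ hx))⟩
    dsimp only
    rw [typeOf_eq_of_mem hut]
    exact (hσ _ v hv hvx rfl).2.2 u hut v (hself v hv) huv.ne (congrArg ι (hNeq u v ht))

/-- If every clique contained in a type `T_v` has size at most `|T_v|/p`, then
any `k`-`L(p,1)`-labeling of `G` can be turned into a good one, i.e. one whose
labels on the twin cover `X` lie in
`{0, …, (2p−1)|X| − p} ∪ {k − (2p−1)|X| + p, …, k}`. -/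
theorem good_labeling_exists {V : Type*} [Fintype V] [DecidableEq V]
    (G : SimpleGraph V) [DecidableRel G.Adj] (p k : ℕ) (hp : 1 ≤ p)
    (X : Finset V) (hX : IsTwinCover G X)
    (hcl : ∀ v : V, v ∉ X → ∀ C : Finset V, G.IsClique ↑C → C ⊆ typeOf G X v →
      p * C.card ≤ (typeOf G X v).card)
    (hf : ∃ f : V → ℕ, IsKLp1Labeling p k G f) :
    ∃ f : V → ℕ, IsKLp1Labeling p k G f ∧ ∀ x ∈ X,
      (f x : ℤ) ≤ (2 * (p : ℤ) - 1) * X.card - p ∨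
      (k : ℤ) - (2 * (p : ℤ) - 1) * X.card + p ≤ (f x : ℤ) := by
  classical
  obtain ⟨f, hfk, hf⟩ := hf
  obtain ⟨π, hπk, hπinj, hπfar, hπend⟩ := exists_compression p k hp (X.image f)
    (fun a ha => by
      obtain ⟨x, -, rfl⟩ := Finset.mem_image.1 ha
      exact hfk x)
  have hgfar : ∀ x ∈ X, ∀ v, G.Adj x v → (p : ℤ) ≤ |(π (f x) : ℤ) - (π (f v) : ℤ)| := by
    intro x hx v h
    have h1 := hf.1 x v h
    rw [le_abs] at h1 ⊢
    have := hπfar (f x) (Finset.mem_image_of_mem f hx) (f v) (hfk v) (by omega)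
    omega
  have hgne : ∀ u v w, u ≠ v → G.Adj u w → G.Adj v w → π (f u) ≠ π (f v) := fun u v w h hu hv he =>
    hf.ne_of_common_neighbor hp h hu hv (hπinj _ _ he)
  obtain ⟨σ, hσmem, hσne, hσfar⟩ := exists_rearrangement_of_types G p hp X hX hcl
    (fun v => π (f v)) hgne
  have hσX : ∀ v, v ∉ X → ∀ x ∈ X, G.Adj v x → σ v ∉ X ∧ G.Adj (σ v) x := fun v hv x hx h =>
    have hm := mem_typeOf.1 (hσmem v hv ⟨x, hx, h⟩)
    ⟨hm.1, (hm.2 x hx).2 h⟩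
  have htwin : ∀ u v, u ∉ X → v ∉ X → G.Adj u v → TrueTwins G u v := fun u v hu hv h =>
    ((hX u v h).resolve_left hu).resolve_left hv
  obtain ⟨h, hh⟩ : ∃ h : V → ℕ, ∀ v, h v = if v ∈ X then π (f v) else
      if ∃ x ∈ X, G.Adj v x then π (f (σ v)) else f v := ⟨_, fun _ => rfl⟩
  have hin : ∀ {v}, v ∈ X → h v = π (f v) := fun hv => by rw [hh, if_pos hv]
  have hnbr : ∀ {v}, v ∉ X → (∃ x ∈ X, G.Adj v x) → h v = π (f (σ v)) := fun hv hx => by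
    rw [hh, if_neg hv, if_pos hx]
  have hfree : ∀ {v}, v ∉ X → (¬ ∃ x ∈ X, G.Adj v x) → h v = f v := fun hv hx => by
    rw [hh, if_neg hv, if_neg hx]
  have hmixed : ∀ u ∈ X, ∀ v, v ∉ X → G.Adj u v → (p : ℤ) ≤ |(h u : ℤ) - (h v : ℤ)| := by
    intro u hu v hv huv
    rw [hin hu, hnbr hv ⟨u, hu, huv.symm⟩]
    exact hgfar u hu _ (hσX v hv u hu huv.symm).2.symm
  have hmixed' : ∀ u ∈ X, ∀ v, v ∉ X → ∀ w, ¬ G.Adj u v → G.Adj u w → G.Adj w v → h u ≠ h v := by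
    intro u hu v hv w huv huw hwv
    by_cases hw : w ∈ X
    · have hs := hσX v hv w hw hwv.symm
      rw [hin hu, hnbr hv ⟨w, hw, hwv.symm⟩]
      exact hgne u _ w (fun e => hs.1 (e ▸ hu)) huw hs.2
    · refine absurd (((htwin w v hw hv hwv).2 u huw.ne ?_).1 huw.symm).symm huv
      rintro rfl
      exact hv hu
  refine ⟨h, ⟨?_, ?_, ?_⟩, ?_⟩
  · intro v
    rw [hh]
    split_ifs
    exacts [hπk _ (hfk _), hπk _ (hfk _), hfk _]
  · intro u v huv
    by_cases hu : u ∈ X <;> by_cases hv : v ∈ X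
    · rw [hin hu, hin hv]
      exact hgfar u hu v huv
    · exact hmixed u hu v hv huv
    · rw [abs_sub_comm]
      exact hmixed v hv u hu huv.symm
    · have ht := htwin u v hu hv huv
      have hiff : (∃ x ∈ X, G.Adj u x) ↔ ∃ x ∈ X, G.Adj v x :=
        exists_congr fun x => and_congr_right fun hx =>
          ht.2 x (fun e => hu (e ▸ hx)) (fun e => hv (e ▸ hx))
      by_cases hx : ∃ x ∈ X, G.Adj v x
      · rw [hnbr hu (hiff.2 hx), hnbr hv hx]
        exact hσfar u v hu hv hx huv
      · rw [hfree hu (mt hiff.1 hx), hfree hv hx]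
        exact hf.1 u v huv
  · rintro u v hne huv ⟨w, huw, hwv⟩
    by_cases hu : u ∈ X <;> by_cases hv : v ∈ X
    · rw [hin hu, hin hv]
      exact hgne u v w hne huw hwv.symm
    · exact hmixed' u hu v hv w huv huw hwv
    · exact (hmixed' v hv u hu w (fun e => huv e.symm) hwv.symm huw.symm).symm
    · by_cases hw : w ∈ X
      · rw [hnbr hu ⟨w, hw, huw⟩, hnbr hv ⟨w, hw, hwv.symm⟩]
        exact hgne _ _ w (hσne u v w hu hv hw huw hwv.symm hne)
          (hσX u hu w hw huw).2 (hσX v hv w hw hwv.symm).2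
      · exact absurd (((htwin w v hw hv hwv).2 u huw.ne hne).1 huw.symm).symm huv
  · intro x hx
    have hend := hπend (f x) (Finset.mem_image_of_mem f hx)
    have hcard : (2 * p - 1) * (X.image f).card ≤ (2 * p - 1) * X.card :=
      Nat.mul_le_mul_left _ Finset.card_image_le
    have hcast : (((2 * p - 1) * X.card : ℕ) : ℤ) = (2 * (p : ℤ) - 1) * X.card := by
      push_cast [Nat.cast_sub (show 1 ≤ 2 * p by omega)]
      ring
    rw [hin hx, ← hcast]
    omega
end
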